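/- Let F be special isothermic of type N ≥ 1 with normalized polynomial conserved quantity P of degree N, and let μ ∈ ℝ∖{0} with μ·a_{ij} ≠ 1 on all edges be a zero of order at least 2 of the real polynomial λ ↦ ⟨P_i(λ),P_i(λ)⟩ (which is independent of the vertex i). Assume F̂_i := P_i(μ) ≠ 0 and ⟨P_i(μ), F_i⟩ ≠ 0 at every vertex, and that F̂ is regular. Then F̂ : M → L⁴ is a Bäcklund transform of (F,P) with parameter μ, and F̂ admits a normalized polynomial conserved quantity P̂ of degree N−1 characterized by (λ−μ)·P̂_i(λ) = Γ^{1−λ/μ}_{F̂_i,F_i}(P_i(λ)) for λ ≠ μ; in particular F̂ is special isothermic of type ≤ N−1. -/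

import Mathlib

noncomputable section

/-- The Minkowski bilinear form of signature (4,1) on `ℝ^5`. -/
def mink (x y : Fin 5 → ℝ) : ℝ :=
  -(x 0 * y 0) + x 1 * y 1 + x 2 * y 2 + x 3 * y 3 + x 4 * y 4

/-- The light cone `L⁴ ⊂ ℝ^{4,1}`. -/
def LightCone (x : Fin 5 → ℝ) : Prop :=
  x ≠ 0 ∧ mink x x = 0

/-- The map `Γ^q_{p,p'}` of the paper. -/
def Gamma (p p' : Fin 5 → ℝ) (q : ℝ) (X : Fin 5 → ℝ) : Fin 5 → ℝ :=
  X + (1 / mink p p') •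
    (((q - 1) * mink X p') • p + ((1 / q - 1) * mink X p) • p')

/-- Two vectors are proportional if one is a scalar multiple of the other. -/
def Proportional (x y : Fin 5 → ℝ) : Prop :=
  (∃ t : ℝ, y = t • x) ∨ (∃ t : ℝ, x = t • y)

/-- Membership in the rectangular grid `M`. -/
def InGrid (m₁ m₂ n₁ n₂ : ℤ) (i : ℤ × ℤ) : Prop :=
  m₁ ≤ i.1 ∧ i.1 ≤ m₂ ∧ n₁ ≤ i.2 ∧ i.2 ≤ n₂

/-- `(i,j)` is an edge of the grid (in either orientation). -/
def IsEdge (m₁ m₂ n₁ n₂ : ℤ) (i j : ℤ × ℤ) : Prop :=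
  InGrid m₁ m₂ n₁ n₂ i ∧ InGrid m₁ m₂ n₁ n₂ j ∧
    ((j.1 = i.1 + 1 ∧ j.2 = i.2) ∨ (i.1 = j.1 + 1 ∧ i.2 = j.2) ∨
     (j.1 = i.1 ∧ j.2 = i.2 + 1) ∨ (i.1 = j.1 ∧ i.2 = j.2 + 1))

/-- `(i,j,k,l)` is an elementary quadrilateral (face) of the grid. -/
def IsFace (m₁ m₂ n₁ n₂ : ℤ) (i j k l : ℤ × ℤ) : Prop :=
  InGrid m₁ m₂ n₁ n₂ i ∧ InGrid m₁ m₂ n₁ n₂ k ∧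
    j = (i.1 + 1, i.2) ∧ k = (i.1 + 1, i.2 + 1) ∧ l = (i.1, i.2 + 1)

/-- Four vectors are pairwise non-proportional. -/
def FaceRegular (v w x y : Fin 5 → ℝ) : Prop :=
  ¬ Proportional v w ∧ ¬ Proportional v x ∧ ¬ Proportional v y ∧
  ¬ Proportional w x ∧ ¬ Proportional w y ∧ ¬ Proportional x y

/-- A discrete isothermic net (with values in the light cone) with cross ratio
factorizing function `a`. -/
structure IsIsothermic (m₁ m₂ n₁ n₂ : ℤ) (F : ℤ × ℤ → Fin 5 → ℝ)
    (a : ℤ × ℤ → ℤ × ℤ → ℝ) : Prop where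
  lightcone : ∀ i, InGrid m₁ m₂ n₁ n₂ i → LightCone (F i)
  regular : ∀ i j k l, IsFace m₁ m₂ n₁ n₂ i j k l →
    FaceRegular (F i) (F j) (F k) (F l)
  symm : ∀ i j, IsEdge m₁ m₂ n₁ n₂ i j → a i j = a j i
  nonzero : ∀ i j, IsEdge m₁ m₂ n₁ n₂ i j → a i j ≠ 0
  opposite : ∀ i j k l, IsFace m₁ m₂ n₁ n₂ i j k l →
    a i j = a l k ∧ a i l = a j k
  cross : ∀ i j k l, IsFace m₁ m₂ n₁ n₂ i j k l →
    ∃ t : ℝ, t ≠ 0 ∧ F k = t • Gamma (F j) (F l) (a i j / a i l) (F i)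

/-- Evaluation of the polynomial with vector coefficients `P i 0, …, P i N`
at the spectral parameter `lam`. -/
def pcqEval (N : ℕ) (P : ℤ × ℤ → ℕ → Fin 5 → ℝ) (i : ℤ × ℤ) (lam : ℝ) :
    Fin 5 → ℝ :=
  ∑ k ∈ Finset.range (N + 1), lam ^ k • P i k

/-- `P` is a polynomial conserved quantity of degree at most `N` of the net `F`
with cross ratio factorizing function `a`. -/
def IsPCQ (m₁ m₂ n₁ n₂ : ℤ) (F : ℤ × ℤ → Fin 5 → ℝ) (a : ℤ × ℤ → ℤ × ℤ → ℝ)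
    (N : ℕ) (P : ℤ × ℤ → ℕ → Fin 5 → ℝ) : Prop :=
  ∀ i j, IsEdge m₁ m₂ n₁ n₂ i j → ∀ lam : ℝ, lam * a i j ≠ 1 →
    pcqEval N P i lam = Gamma (F i) (F j) (1 - lam * a i j) (pcqEval N P j lam)

/-- A polynomial conserved quantity is normalized (of degree `N`) if its top
coefficient has Minkowski square norm one at every vertex. -/
def Normalized (m₁ m₂ n₁ n₂ : ℤ) (N : ℕ) (P : ℤ × ℤ → ℕ → Fin 5 → ℝ) : Prop :=
  ∀ i, InGrid m₁ m₂ n₁ n₂ i → mink (P i N) (P i N) = 1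

/-- A Darboux transform of `F` with parameter `μ`. -/
def IsDarboux (m₁ m₂ n₁ n₂ : ℤ) (F : ℤ × ℤ → Fin 5 → ℝ) (a : ℤ × ℤ → ℤ × ℤ → ℝ)
    (μ : ℝ) (Fh : ℤ × ℤ → Fin 5 → ℝ) : Prop :=
  (∀ i, InGrid m₁ m₂ n₁ n₂ i → LightCone (Fh i)) ∧
  (∀ i, InGrid m₁ m₂ n₁ n₂ i → ¬ Proportional (F i) (Fh i)) ∧
  (∀ i j, IsEdge m₁ m₂ n₁ n₂ i j → Fh i = Gamma (F i) (F j) (1 - μ * a i j) (Fh j))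

/-- A Calapso transformation of `F` at parameter `μ`: a vertexwise family of
linear isometries of `ℝ^{4,1}` gauging the isothermic connection at `μ` to the
trivial connection. -/
def IsCalapso (m₁ m₂ n₁ n₂ : ℤ) (F : ℤ × ℤ → Fin 5 → ℝ) (a : ℤ × ℤ → ℤ × ℤ → ℝ)
    (μ : ℝ) (T : ℤ × ℤ → (Fin 5 → ℝ) → (Fin 5 → ℝ)) : Prop :=
  (∀ i, InGrid m₁ m₂ n₁ n₂ i → IsLinearMap ℝ (T i)) ∧
  (∀ i, InGrid m₁ m₂ n₁ n₂ i → ∀ x y, mink (T i x) (T i y) = mink x y) ∧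
  (∀ i j, IsEdge m₁ m₂ n₁ n₂ i j → ∀ x,
    T j x = T i (Gamma (F i) (F j) (1 - μ * a i j) x))

open Polynomial in
theorem aux_quot_coeff (m : ℝ) (M : ℕ) (q p : ℝ[X]) (h : p = (X - C m) * q)
    (hp : p.natDegree ≤ M + 1) : q.natDegree ≤ M ∧ p.coeff (M + 1) = q.coeff M := by
  by_cases hq : q = 0
  · subst hq; subst h; simp
  have hd : q.natDegree ≤ M := by
    have : p.natDegree = 1 + q.natDegree := by
      rw [h, natDegree_mul (X_sub_C_ne_zero m) hq, natDegree_X_sub_C]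
    omega
  refine ⟨hd, ?_⟩
  have : q.coeff (M + 1) = 0 := coeff_eq_zero_of_natDegree_lt (by omega)
  rw [h, sub_mul, coeff_sub, coeff_X_mul, coeff_C_mul, this]; ring

theorem mink_comm' (x y : Fin 5 → ℝ) : mink x y = mink y x := by
  unfold mink; ring

theorem mink_add_left' (x y z : Fin 5 → ℝ) : mink (x + y) z = mink x z + mink y z := by
  simp only [mink, Pi.add_apply]; ring

theorem mink_smul_left' (t : ℝ) (x z : Fin 5 → ℝ) : mink (t • x) z = t * mink x z := by
  simp only [mink, Pi.smul_apply, smul_eq_mul]; ring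

theorem mink_add_right' (x y z : Fin 5 → ℝ) : mink z (x + y) = mink z x + mink z y := by
  simp only [mink, Pi.add_apply]; ring

theorem mink_smul_right' (t : ℝ) (x z : Fin 5 → ℝ) : mink z (t • x) = t * mink z x := by
  simp only [mink, Pi.smul_apply, smul_eq_mul]; ring

theorem Gamma_smul' (p p' : Fin 5 → ℝ) (q t : ℝ) (X : Fin 5 → ℝ) :
    Gamma p p' q (t • X) = t • Gamma p p' q X := by
  ext k
  simp only [Gamma, mink_smul_left', Pi.add_apply, Pi.smul_apply, smul_eq_mul]; ring

/-- null vectors in the light cone that are orthogonal are proportional -/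
theorem lightcone_mink_ne (x y : Fin 5 → ℝ) (hx : LightCone x) (hy : LightCone y)
    (h : ¬ Proportional x y) : mink x y ≠ 0 := by
  intro h0
  apply h
  obtain ⟨hx0, hxx⟩ := hx
  obtain ⟨hy0, hyy⟩ := hy
  have hx00 : x 0 ≠ 0 := by
    intro h00
    apply hx0
    simp only [mink, h00] at hxx
    have h1 : x 1 = 0 := by nlinarith [sq_nonneg (x 1), sq_nonneg (x 2), sq_nonneg (x 3), sq_nonneg (x 4)]
    have h2 : x 2 = 0 := by nlinarith [sq_nonneg (x 1), sq_nonneg (x 2), sq_nonneg (x 3), sq_nonneg (x 4)]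
    have h3 : x 3 = 0 := by nlinarith [sq_nonneg (x 1), sq_nonneg (x 2), sq_nonneg (x 3), sq_nonneg (x 4)]
    have h4 : x 4 = 0 := by nlinarith [sq_nonneg (x 1), sq_nonneg (x 2), sq_nonneg (x 3), sq_nonneg (x 4)]
    ext k; fin_cases k <;> simp [h00, h1, h2, h3, h4]
  have key : (x 0 * y 1 - y 0 * x 1)^2 + (x 0 * y 2 - y 0 * x 2)^2
      + (x 0 * y 3 - y 0 * x 3)^2 + (x 0 * y 4 - y 0 * x 4)^2 = 0 := by
    simp only [mink] at hxx hyy h0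
    linear_combination (x 0)^2 * hyy + (y 0)^2 * hxx - 2 * x 0 * y 0 * h0
  have e1 : x 0 * y 1 - y 0 * x 1 = 0 := by
    apply pow_eq_zero_iff (two_ne_zero) |>.1
    nlinarith [sq_nonneg (x 0 * y 1 - y 0 * x 1), sq_nonneg (x 0 * y 2 - y 0 * x 2), sq_nonneg (x 0 * y 3 - y 0 * x 3), sq_nonneg (x 0 * y 4 - y 0 * x 4)]
  have e2 : x 0 * y 2 - y 0 * x 2 = 0 := by
    apply pow_eq_zero_iff (two_ne_zero) |>.1
    nlinarith [sq_nonneg (x 0 * y 1 - y 0 * x 1), sq_nonneg (x 0 * y 2 - y 0 * x 2), sq_nonneg (x 0 * y 3 - y 0 * x 3), sq_nonneg (x 0 * y 4 - y 0 * x 4)]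
  have e3 : x 0 * y 3 - y 0 * x 3 = 0 := by
    apply pow_eq_zero_iff (two_ne_zero) |>.1
    nlinarith [sq_nonneg (x 0 * y 1 - y 0 * x 1), sq_nonneg (x 0 * y 2 - y 0 * x 2), sq_nonneg (x 0 * y 3 - y 0 * x 3), sq_nonneg (x 0 * y 4 - y 0 * x 4)]
  have e4 : x 0 * y 4 - y 0 * x 4 = 0 := by
    apply pow_eq_zero_iff (two_ne_zero) |>.1
    nlinarith [sq_nonneg (x 0 * y 1 - y 0 * x 1), sq_nonneg (x 0 * y 2 - y 0 * x 2), sq_nonneg (x 0 * y 3 - y 0 * x 3), sq_nonneg (x 0 * y 4 - y 0 * x 4)]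
  left
  refine ⟨y 0 / x 0, ?_⟩
  ext k
  fin_cases k <;> simp <;> field_simp <;> linarith

theorem mink_Gamma_right (p p' X : Fin 5 → ℝ) (q : ℝ) (hp' : mink p' p' = 0)
    (h : mink p p' ≠ 0) : mink (Gamma p p' q X) p' = q * mink X p' := by
  simp only [Gamma, mink_add_left', mink_smul_left', hp']
  field_simp; ring

theorem mink_Gamma_left (p p' X : Fin 5 → ℝ) (q : ℝ) (hp : mink p p = 0)
    (h : mink p p' ≠ 0) (hq : q ≠ 0) : mink (Gamma p p' q X) p = 1 / q * mink X p := by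
  simp only [Gamma, mink_add_left', mink_smul_left', hp, mink_comm' p' p]
  field_simp; ring

/-- permutability of the connections -/
theorem gamma_perm (A B D X : Fin 5 → ℝ) (a l m : ℝ) (hm : m ≠ 0)
    (hlm : l ≠ m) (hla : l * a ≠ 1) (hma : m * a ≠ 1)
    (hA : mink A A = 0) (hB : mink B B = 0) (hD : mink D D = 0)
    (hAB : mink A B ≠ 0) (hDB : mink D B ≠ 0)
    (hCD : mink (Gamma A B (1 - m * a) D) D ≠ 0) :
    Gamma (Gamma A B (1 - m * a) D) D (1 - l * a) (Gamma D B (1 - l / m) X)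
      = Gamma (Gamma A B (1 - m * a) D) A (1 - l / m) (Gamma A B (1 - l * a) X) := by
  have h1 : 1 - m * a ≠ 0 := fun h => hma (by linarith)
  have h2 : 1 - l * a ≠ 0 := fun h => hla (by linarith)
  have h3 : m - l ≠ 0 := fun h => hlm (by linarith)
  have e3 : 1 - l / m = (m - l) / m := by field_simp
  have eCA := mink_Gamma_left A B D (1 - m * a) hA hAB h1
  set c := Gamma A B (1 - m * a) D with hc
  have eCD : mink c D = mink A D * mink D B / mink A B * (m * a) * (m * a) / (1 - m * a) := by
    rw [hc]
    simp only [Gamma, mink_add_left', mink_smul_left', hD, mink_comm' D A, mink_comm' B D]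
    field_simp; ring
  have hCD' := hCD
  rw [eCD] at hCD'
  have ha : a ≠ 0 := by rintro rfl; simp at hCD'
  have hAD : mink A D ≠ 0 := by intro h; simp [h] at hCD'
  have eXC : ∀ Y, mink Y c = mink Y D + (1 / mink A B) * ((-(m * a)) * mink D B * mink Y A
      + (m * a / (1 - m * a)) * mink A D * mink Y B) := by
    intro Y
    rw [hc]
    simp only [Gamma, mink_add_right', mink_smul_right', mink_comm' D A]
    field_simp; ring
  have hcv : ∀ k, c k = D k + (1 / mink A B) * ((-(m * a)) * mink D B * A k
      + (m * a / (1 - m * a)) * mink A D * B k) := by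
    intro k
    rw [hc]
    simp only [Gamma, Pi.add_apply, Pi.smul_apply, smul_eq_mul, mink_comm' D A]
    field_simp; ring
  ext k
  rw [e3]
  simp only [Gamma, Pi.add_apply, Pi.smul_apply, smul_eq_mul, mink_add_left', mink_smul_left',
    eCA, eCD, eXC, hcv, hA, hB, hD, mink_comm' D A, mink_comm' B A, mink_comm' B D]
  generalize mink A B = u at *
  generalize mink A D = v at *
  generalize mink D B = w at *
  generalize mink X A = xa
  generalize mink X B = xb
  generalize mink X D = xd
  field_simp
  ring

/-- coordinate polynomials -/
def cpoly (N : ℕ) (Q : ℕ → Fin 5 → ℝ) (k : Fin 5) : Polynomial ℝ :=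
  ∑ n ∈ Finset.range (N + 1), Polynomial.C (Q n k) * Polynomial.X ^ n

/-- pairing of coordinate polynomials with a constant vector -/
def mpoly (N : ℕ) (Q : ℕ → Fin 5 → ℝ) (v : Fin 5 → ℝ) : Polynomial ℝ :=
  -(cpoly N Q 0 * Polynomial.C (v 0)) + cpoly N Q 1 * Polynomial.C (v 1)
    + cpoly N Q 2 * Polynomial.C (v 2) + cpoly N Q 3 * Polynomial.C (v 3)
    + cpoly N Q 4 * Polynomial.C (v 4)

theorem cpoly_coeff (N : ℕ) (Q : ℕ → Fin 5 → ℝ) (k : Fin 5) (n : ℕ) :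
    (cpoly N Q k).coeff n = if n ≤ N then Q n k else 0 := by
  unfold cpoly
  simp only [Polynomial.finsetSum_coeff, Polynomial.coeff_C_mul, Polynomial.coeff_X_pow]
  simp [Nat.lt_succ_iff]

theorem cpoly_eval (N : ℕ) (Q : ℕ → Fin 5 → ℝ) (k : Fin 5) (l : ℝ) :
    (cpoly N Q k).eval l = (∑ n ∈ Finset.range (N + 1), l ^ n • Q n) k := by
  unfold cpoly
  rw [Polynomial.eval_finsetSum, Finset.sum_apply]
  refine Finset.sum_congr rfl (fun n _ => ?_)
  simp only [Polynomial.eval_mul, Polynomial.eval_C, Polynomial.eval_pow, Polynomial.eval_X,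
    Pi.smul_apply, smul_eq_mul]
  ring

theorem mpoly_coeff (N : ℕ) (Q : ℕ → Fin 5 → ℝ) (v : Fin 5 → ℝ) (n : ℕ) :
    (mpoly N Q v).coeff n = if n ≤ N then mink (Q n) v else 0 := by
  unfold mpoly
  simp only [Polynomial.coeff_add, Polynomial.coeff_neg, Polynomial.coeff_mul_C, cpoly_coeff]
  split_ifs <;> simp [mink]

theorem mpoly_eval (N : ℕ) (Q : ℕ → Fin 5 → ℝ) (v : Fin 5 → ℝ) (l : ℝ) :
    (mpoly N Q v).eval l = mink (∑ n ∈ Finset.range (N + 1), l ^ n • Q n) v := by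
  unfold mpoly
  simp only [Polynomial.eval_add, Polynomial.eval_neg, Polynomial.eval_mul, Polynomial.eval_C,
    cpoly_eval, mink]

theorem top_orth (N : ℕ) (Q R : ℕ → Fin 5 → ℝ) (v : Fin 5 → ℝ) (a : ℝ) (ha : a ≠ 0)
    (h : ∀ l : ℝ, l * a ≠ 1 → mink (∑ n ∈ Finset.range (N + 1), l ^ n • R n) v =
      (1 - l * a) * mink (∑ n ∈ Finset.range (N + 1), l ^ n • Q n) v) :
    mink (Q N) v = 0 := by
  have e : mpoly N R v = (1 - Polynomial.X * Polynomial.C a) * mpoly N Q v := by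
    apply Polynomial.eq_of_infinite_eval_eq
    have : ({1 / a}ᶜ : Set ℝ).Infinite := (Set.finite_singleton (1 / a)).infinite_compl
    refine this.mono ?_
    intro l hl
    simp only [Set.mem_compl_iff, Set.mem_singleton_iff] at hl
    simp only [Set.mem_setOf_eq, Polynomial.eval_mul, Polynomial.eval_sub, Polynomial.eval_one,
      Polynomial.eval_X, Polynomial.eval_C, mpoly_eval]
    apply h
    intro hh
    exact hl (by rw [eq_div_iff ha]; exact hh)
  have e2 := congrArg (fun p => Polynomial.coeff p (N + 1)) e
  simp only [sub_mul, one_mul, mul_assoc, Polynomial.coeff_sub, Polynomial.coeff_X_mul,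
    Polynomial.coeff_C_mul, mpoly_coeff] at e2
  simpa [ha] using e2

open Polynomial in
theorem vertex_lemma (M : ℕ) (Q : ℕ → Fin 5 → ℝ) (v w : Fin 5 → ℝ) (m : ℝ) (hm : m ≠ 0)
    (hw : w = ∑ n ∈ Finset.range (M + 1 + 1), m ^ n • Q n)
    (hv : mink v v = 0) (hww : mink w w = 0) (hwv : mink w v ≠ 0)
    (htop : mink (Q (M + 1)) v = 0) (hnorm : mink (Q (M + 1)) (Q (M + 1)) = 1)
    (hd : deriv (fun l : ℝ => mink (∑ n ∈ Finset.range (M + 1 + 1), l ^ n • Q n)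
      (∑ n ∈ Finset.range (M + 1 + 1), l ^ n • Q n)) m = 0) :
    ∃ R : ℕ → Fin 5 → ℝ, mink (R M) (R M) = 1 ∧
      ∀ l : ℝ, l ≠ m → (l - m) • (∑ n ∈ Finset.range (M + 1), l ^ n • R n) =
        Gamma w v (1 - l / m) (∑ n ∈ Finset.range (M + 1 + 1), l ^ n • Q n) := by
  set f := mpoly (M + 1) Q v with hf
  set g := mpoly (M + 1) Q w with hg
  set p := cpoly (M + 1) Q with hp
  have hpm : ∀ k, (p k).eval m = w k := fun k => by rw [hp, cpoly_eval, hw]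
  have hgm : g.eval m = 0 := by rw [hg, mpoly_eval, ← hw, hww]
  have hfm : f.eval m = mink w v := by rw [hf, mpoly_eval, ← hw]
  -- derivative
  have hgd : (derivative g).eval m = 0 := by
    set S : ℝ[X] := -(p 0 * p 0) + p 1 * p 1 + p 2 * p 2 + p 3 * p 3 + p 4 * p 4 with hS
    have hfun : (fun l : ℝ => mink (∑ n ∈ Finset.range (M + 1 + 1), l ^ n • Q n)
      (∑ n ∈ Finset.range (M + 1 + 1), l ^ n • Q n)) = fun l => S.eval l := by
      funext l
      simp only [hS, hp, eval_add, eval_neg, eval_mul, cpoly_eval, mink]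
    rw [hfun, Polynomial.deriv] at hd
    have h2 : (derivative S).eval m = 2 * (derivative g).eval m := by
      simp only [hS, hg, mpoly, ← hp, derivative_add, derivative_neg, derivative_mul,
        derivative_C, eval_add, eval_neg, eval_mul, eval_C, hpm, eval_zero]
      ring
    linarith
  obtain ⟨h1, hh1⟩ : (X - C m) ∣ g := dvd_iff_isRoot.2 hgm
  have hh1m : h1.eval m = 0 := by
    rw [hh1] at hgd
    simpa [derivative_mul] using hgd
  have hgdeg : g.natDegree ≤ M + 1 := natDegree_le_iff_coeff_eq_zero.2 (fun n hn => by
    rw [hg, mpoly_coeff, if_neg (by omega)])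
  obtain ⟨hh1deg, hh1c⟩ := aux_quot_coeff m M h1 g hh1 hgdeg
  have hfdeg : f.natDegree ≤ M := natDegree_le_iff_coeff_eq_zero.2 (fun n hn => by
    rw [hf, mpoly_coeff]
    split_ifs with h
    · have : n = M + 1 := by omega
      rw [this, htop]
    · rfl)
  have hpdeg : ∀ k, (p k).natDegree ≤ M + 1 := fun k =>
    natDegree_le_iff_coeff_eq_zero.2 (fun n hn => by
      rw [hp, cpoly_coeff, if_neg (by omega)])
  set num : Fin 5 → ℝ[X] := fun k => p k - C (w k / (mink w v * m)) * (X * f)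
    - C (v k / mink w v) * (X * h1) with hnum
  have hnum0 : ∀ k, (num k).eval m = 0 := by
    intro k
    simp only [hnum, eval_sub, eval_mul, eval_C, eval_X, hpm, hfm, hh1m]
    field_simp; ring
  have hdv : ∀ k, ∃ r, num k = (X - C m) * r := fun k => dvd_iff_isRoot.2 (hnum0 k)
  choose r hr using hdv
  have hnumdeg : ∀ k, (num k).natDegree ≤ M + 1 := by
    intro k
    refine natDegree_le_iff_coeff_eq_zero.2 (fun n hn => ?_)
    obtain ⟨n', rfl⟩ : ∃ n', n = n' + 1 := ⟨n - 1, by omega⟩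
    simp only [hnum, coeff_sub, coeff_C_mul, coeff_X_mul]
    rw [coeff_eq_zero_of_natDegree_lt (lt_of_le_of_lt (hpdeg k) hn),
      coeff_eq_zero_of_natDegree_lt (p := f) (by omega),
      coeff_eq_zero_of_natDegree_lt (p := h1) (by omega)]
    ring
  have hrr := fun k => aux_quot_coeff m M (r k) (num k) (hr k) (hnumdeg k)
  refine ⟨fun n k => (r k).coeff n, ?_, ?_⟩
  · have hc : (fun k => (r k).coeff M) = Q (M + 1) +
        ((-(f.coeff M / (mink w v * m))) • w + (-(mink (Q (M + 1)) w / mink w v)) • v) := by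
      funext k
      rw [← (hrr k).2]
      have : h1.coeff M = mink (Q (M + 1)) w := by
        rw [← hh1c, hg, mpoly_coeff, if_pos le_rfl]
      simp only [hnum, coeff_sub, coeff_C_mul, coeff_X_mul, hp, cpoly_coeff, this, le_refl,
        if_true, Pi.add_apply, Pi.smul_apply, smul_eq_mul]
      ring
    change mink (fun k => (r k).coeff M) (fun k => (r k).coeff M) = 1
    rw [hc]
    simp only [mink_add_left', mink_add_right', mink_smul_left', mink_smul_right', hv, hww, hnorm,
      htop, mink_comm' w (Q (M + 1)), mink_comm' v (Q (M + 1)), mink_comm' v w]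
    field_simp; ring
  · intro l hl
    have hl' : l - m ≠ 0 := sub_ne_zero.2 hl
    have hl2 : m - l ≠ 0 := sub_ne_zero.2 (Ne.symm hl)
    funext k
    have e1 : (∑ n ∈ Finset.range (M + 1), l ^ n • (fun k => (r k).coeff n)) k
        = (r k).eval l := by
      rw [eval_eq_sum_range' (Nat.lt_succ_of_le (hrr k).1)]
      simp [Finset.sum_apply, mul_comm]
    have e2 : (l - m) * (r k).eval l = (num k).eval l := by
      rw [hr k]; simp
    have e3 : g.eval l = (l - m) * h1.eval l := by rw [hh1]; simp
    have e4 : 1 - l / m = (m - l) / m := by field_simp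
    rw [Pi.smul_apply, e1, smul_eq_mul, e2]
    rw [hg, mpoly_eval] at e3
    simp only [Gamma, Pi.add_apply, Pi.smul_apply, smul_eq_mul]
    rw [e3]
    simp only [hnum, eval_sub, eval_mul, eval_C, eval_X, hp, cpoly_eval, hf, mpoly_eval]
    rw [e4]
    field_simp
    ring

theorem edge_in_face (m₁ m₂ n₁ n₂ : ℤ) (hm : m₁ < m₂) (hn : n₁ < n₂) (G : ℤ × ℤ → Fin 5 → ℝ)
    (hreg : ∀ i j k l, IsFace m₁ m₂ n₁ n₂ i j k l → FaceRegular (G i) (G j) (G k) (G l))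
    (i j : ℤ × ℤ) (h : IsEdge m₁ m₂ n₁ n₂ i j) : ¬ Proportional (G i) (G j) := by
  have sy : ∀ x y : Fin 5 → ℝ, Proportional x y → Proportional y x := fun x y h => h.symm
  obtain ⟨x, y⟩ := i
  obtain ⟨z, t⟩ := j
  have H : ∀ s u : ℤ, m₁ ≤ s → s + 1 ≤ m₂ → n₁ ≤ u → u + 1 ≤ n₂ →
      FaceRegular (G (s, u)) (G (s + 1, u)) (G (s + 1, u + 1)) (G (s, u + 1)) :=
    fun s u h1 h2 h3 h4 => hreg _ _ _ _
      ⟨⟨h1, by dsimp; omega, h3, by dsimp; omega⟩, ⟨by dsimp; omega, h2, by dsimp; omega, h4⟩,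
        rfl, rfl, rfl⟩
  have Hh : ∀ s u : ℤ, m₁ ≤ s → s + 1 ≤ m₂ → n₁ ≤ u → u ≤ n₂ →
      ¬ Proportional (G (s, u)) (G (s + 1, u)) := by
    intro s u h1 h2 h3 h4
    by_cases hu : u + 1 ≤ n₂
    · exact (H s u h1 h2 h3 hu).1
    · have := (H s (u - 1) h1 h2 (by omega) (by omega)).2.2.2.2.2
      rw [sub_add_cancel] at this
      exact fun hh => this (sy _ _ hh)
  have Hv : ∀ s u : ℤ, m₁ ≤ s → s ≤ m₂ → n₁ ≤ u → u + 1 ≤ n₂ →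
      ¬ Proportional (G (s, u)) (G (s, u + 1)) := by
    intro s u h1 h2 h3 h4
    by_cases hu : s + 1 ≤ m₂
    · exact (H s u h1 hu h3 h4).2.2.1
    · have := (H (s - 1) u (by omega) (by omega) h3 h4).2.2.2.1
      rwa [sub_add_cancel] at this
  obtain ⟨⟨a1, a2, a3, a4⟩, ⟨b1, b2, b3, b4⟩, h⟩ := h
  dsimp at *
  rcases h with ⟨rfl, rfl⟩ | ⟨rfl, rfl⟩ | ⟨rfl, rfl⟩ | ⟨rfl, rfl⟩
  · exact Hh _ _ a1 b2 a3 a4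
  · exact fun hh => Hh _ _ b1 a2 a3 a4 (sy _ _ hh)
  · exact Hv _ _ a1 a2 a3 b4
  · exact fun hh => Hv _ _ a1 a2 b3 a4 (sy _ _ hh)

theorem exists_edge (m₁ m₂ n₁ n₂ : ℤ) (hm : m₁ < m₂) (i : ℤ × ℤ)
    (h : InGrid m₁ m₂ n₁ n₂ i) : ∃ j, IsEdge m₁ m₂ n₁ n₂ j i := by
  obtain ⟨x, y⟩ := i
  obtain ⟨h1, h2, h3, h4⟩ := h
  dsimp at *
  by_cases hx : x + 1 ≤ m₂
  · refine ⟨(x + 1, y), ⟨?_, hx, h3, h4⟩, ⟨h1, h2, h3, h4⟩, Or.inr (Or.inl ⟨rfl, rfl⟩)⟩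
    dsimp; omega
  · refine ⟨(x - 1, y), ⟨?_, ?_, h3, h4⟩, ⟨h1, h2, h3, h4⟩, Or.inl ⟨?_, rfl⟩⟩ <;> dsimp <;> omega

theorem Gamma_cont (p p' : Fin 5 → ℝ) (a m : ℝ) (hm : m * a ≠ 1) (Y : ℝ → Fin 5 → ℝ)
    (hY : Continuous Y) : ContinuousAt (fun l => Gamma p p' (1 - l * a) (Y l)) m := by
  have h : 1 - m * a ≠ 0 := fun h => hm (by linarith)
  have hYk : ∀ k, Continuous fun l => Y l k := fun k => (continuous_apply k).comp hY
  have hM : ∀ v, Continuous fun l => mink (Y l) v := by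
    intro v
    have := hYk 0
    have := hYk 1
    have := hYk 2
    have := hYk 3
    have := hYk 4
    unfold mink
    fun_prop
  have := (hM p).continuousAt (x := m)
  have := (hM p').continuousAt (x := m)
  have hq : ContinuousAt (fun l => 1 / (1 - l * a)) m :=
    ContinuousAt.div (by fun_prop) (by fun_prop) h
  have := hY.continuousAt (x := m)
  unfold Gamma
  fun_prop

/-- a higher order zero `μ` of `|P(λ)|²` yields a type-lowering
Bäcklund transform `F̂ = P(μ)` of a special isothermic net of type `N`. -/
theorem statement16 (m₁ m₂ n₁ n₂ : ℤ) (hm : m₁ < m₂) (hn : n₁ < n₂)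
    (F : ℤ × ℤ → Fin 5 → ℝ) (a : ℤ × ℤ → ℤ × ℤ → ℝ) (N : ℕ) (hN : 1 ≤ N)
    (hiso : IsIsothermic m₁ m₂ n₁ n₂ F a)
    (P : ℤ × ℤ → ℕ → Fin 5 → ℝ)
    (hP : IsPCQ m₁ m₂ n₁ n₂ F a N P) (hPnorm : Normalized m₁ m₂ n₁ n₂ N P)
    (hmin : ∀ K : ℕ, K < N → ∀ P' : ℤ × ℤ → ℕ → Fin 5 → ℝ,
      IsPCQ m₁ m₂ n₁ n₂ F a K P' → ¬ Normalized m₁ m₂ n₁ n₂ K P')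
    (μ : ℝ) (hμ0 : μ ≠ 0)
    (hadm : ∀ i j, IsEdge m₁ m₂ n₁ n₂ i j → μ * a i j ≠ 1)
    (hzero : ∀ i, InGrid m₁ m₂ n₁ n₂ i →
      mink (pcqEval N P i μ) (pcqEval N P i μ) = 0)
    (hzero' : ∀ i, InGrid m₁ m₂ n₁ n₂ i →
      deriv (fun lam : ℝ => mink (pcqEval N P i lam) (pcqEval N P i lam)) μ = 0)
    (hne : ∀ i, InGrid m₁ m₂ n₁ n₂ i → pcqEval N P i μ ≠ 0)
    (hprod : ∀ i, InGrid m₁ m₂ n₁ n₂ i → mink (pcqEval N P i μ) (F i) ≠ 0)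
    (hreg : ∀ i j k l, IsFace m₁ m₂ n₁ n₂ i j k l →
      FaceRegular (pcqEval N P i μ) (pcqEval N P j μ)
        (pcqEval N P k μ) (pcqEval N P l μ)) :
    IsDarboux m₁ m₂ n₁ n₂ F a μ (fun i => pcqEval N P i μ) ∧
    (∀ i, InGrid m₁ m₂ n₁ n₂ i →
      mink (pcqEval N P i μ) (pcqEval N P i μ) = 0) ∧
    (∃ C : ℤ × ℤ → ℕ → Fin 5 → ℝ,
      IsPCQ m₁ m₂ n₁ n₂ (fun i => pcqEval N P i μ) a (N - 1) C ∧
      Normalized m₁ m₂ n₁ n₂ (N - 1) C ∧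
      (∀ i, InGrid m₁ m₂ n₁ n₂ i → ∀ lam : ℝ, lam ≠ μ →
        (lam - μ) • pcqEval (N - 1) C i lam
          = Gamma (pcqEval N P i μ) (F i) (1 - lam / μ)
              (pcqEval N P i lam))) := by
  obtain ⟨M, rfl⟩ : ∃ M, N = M + 1 := ⟨N - 1, by omega⟩
  have hL : ∀ i, InGrid m₁ m₂ n₁ n₂ i → LightCone (pcqEval (M + 1) P i μ) :=
    fun i hi => ⟨hne i hi, hzero i hi⟩
  have hAB : ∀ i j, IsEdge m₁ m₂ n₁ n₂ i j → mink (F i) (F j) ≠ 0 := fun i j h =>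
    lightcone_mink_ne _ _ (hiso.lightcone i h.1) (hiso.lightcone j h.2.1)
      (edge_in_face m₁ m₂ n₁ n₂ hm hn F hiso.regular i j h)
  have hCD : ∀ i j, IsEdge m₁ m₂ n₁ n₂ i j →
      mink (pcqEval (M + 1) P i μ) (pcqEval (M + 1) P j μ) ≠ 0 := fun i j h =>
    lightcone_mink_ne _ _ (hL i h.1) (hL j h.2.1)
      (edge_in_face m₁ m₂ n₁ n₂ hm hn (fun i => pcqEval (M + 1) P i μ) hreg i j h)
  have hFF : ∀ i, InGrid m₁ m₂ n₁ n₂ i → mink (F i) (F i) = 0 :=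
    fun i hi => (hiso.lightcone i hi).2
  have htop : ∀ i, InGrid m₁ m₂ n₁ n₂ i → mink (P i (M + 1)) (F i) = 0 := by
    intro i hi
    obtain ⟨j, hj⟩ := exists_edge m₁ m₂ n₁ n₂ hm i hi
    apply top_orth (M + 1) (P i) (P j) (F i) (a j i) (hiso.nonzero j i hj)
    intro l hl
    have e := hP j i hj l hl
    have e2 := mink_Gamma_right (F j) (F i) (pcqEval (M + 1) P i l) (1 - l * a j i)
      (hFF i hi) (hAB j i hj)
    rw [← e] at e2
    exact e2
  refine ⟨⟨hL, ?_, fun i j h => hP i j h μ (hadm i j h)⟩, hzero, ?_⟩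
  · rintro i hi (⟨t, ht⟩ | ⟨t, ht⟩)
    · apply hprod i hi
      dsimp only at ht
      rw [ht, mink_smul_left', hFF i hi, mul_zero]
    · apply hprod i hi
      dsimp only at ht
      rw [ht, mink_smul_right', hzero i hi, mul_zero]
  have hex : ∀ i, ∃ R : ℕ → Fin 5 → ℝ, InGrid m₁ m₂ n₁ n₂ i → (mink (R M) (R M) = 1 ∧
      ∀ l : ℝ, l ≠ μ → (l - μ) • (∑ n ∈ Finset.range (M + 1), l ^ n • R n) =
        Gamma (pcqEval (M + 1) P i μ) (F i) (1 - l / μ) (pcqEval (M + 1) P i l)) := by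
    intro i
    by_cases hi : InGrid m₁ m₂ n₁ n₂ i
    · obtain ⟨R, hR⟩ := vertex_lemma M (P i) (F i) (pcqEval (M + 1) P i μ) μ hμ0 rfl
        (hFF i hi) (hzero i hi) (hprod i hi) (htop i hi) (hPnorm i hi) (hzero' i hi)
      exact ⟨R, fun _ => hR⟩
    · exact ⟨0, fun h => absurd h hi⟩
  choose R hR using hex
  have hcont : ∀ i, Continuous (fun l => pcqEval M R i l) := by
    intro i; unfold pcqEval; fun_prop
  refine ⟨R, ?_, fun i hi => (hR i hi).1, fun i hi l hl => (hR i hi).2 l hl⟩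
  intro i j h
  rw [Nat.add_sub_cancel]
  have main : ∀ l : ℝ, l ≠ μ → l * a i j ≠ 1 → pcqEval M R i l =
      Gamma (pcqEval (M + 1) P i μ) (pcqEval (M + 1) P j μ) (1 - l * a i j)
        (pcqEval M R j l) := by
    intro l hl hla
    have hl' : l - μ ≠ 0 := sub_ne_zero.2 hl
    apply smul_right_injective _ hl'
    change (l - μ) • _ = (l - μ) • _
    rw [← Gamma_smul']
    have e1 : (l - μ) • pcqEval M R i l = _ := (hR i h.1).2 l hl
    have e2 : (l - μ) • pcqEval M R j l = _ := (hR j h.2.1).2 l hl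
    rw [e1, e2]
    have e3 := hP i j h l hla
    have e4 := hP i j h μ (hadm i j h)
    have hcd := hCD i j h
    rw [e3]
    rw [e4] at hcd ⊢
    exact (gamma_perm (F i) (F j) (pcqEval (M + 1) P j μ) (pcqEval (M + 1) P j l) (a i j) l μ
      hμ0 hl hla (hadm i j h) (hFF i h.1) (hFF j h.2.1) (hzero j h.2.1) (hAB i j h)
      (hprod j h.2.1) hcd).symm
  intro l hla
  by_cases hl : l = μ
  · subst hl
    have c1 := ((hcont i).continuousAt (x := l)).tendsto.mono_left
      (nhdsWithin_le_nhds (s := {l}ᶜ))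
    have c2 := (Gamma_cont (pcqEval (M + 1) P i l) (pcqEval (M + 1) P j l) (a i j) l hla
      (fun x => pcqEval M R j x) (hcont j)).tendsto.mono_left (nhdsWithin_le_nhds (s := {l}ᶜ))
    refine tendsto_nhds_unique_of_eventuallyEq c1 c2 ?_
    have ev : ∀ᶠ x in nhds l, x * a i j ≠ 1 :=
      ContinuousAt.eventually_ne (by fun_prop) hla
    filter_upwards [self_mem_nhdsWithin, ev.filter_mono nhdsWithin_le_nhds] with x hx hx2
    exact main x hx hx2
  · exact main l hl hla
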